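/- Let A be an m×n complex matrix with singular value decomposition A|λₙ⟩ = λₙ|ηₙ⟩. Define the 2(m+n)-dimensional Hermitian matrix H = [[0, γI, 0, 0],[γI, 0, A, 0],[0, A†, 0, γI],[0, 0, γI, 0]] (block form, with identity blocks of appropriate sizes). Then for each singular triple (λ, |λ⟩, |η⟩), the 4-dimensional subspace spanned by |1⟩|η⟩, |2⟩|η⟩, |3⟩|λ⟩, |4⟩|λ⟩ is invariant under H, and in the basis {(|1⟩|η⟩+|4⟩|λ⟩)/√2, (|2⟩|η⟩+|3⟩|λ⟩)/√2, (|1⟩|η⟩−|4⟩|λ⟩)/√2, (|2⟩|η⟩−|3⟩|λ⟩)/√2} the restriction of H is the block-diagonal matrix [[0,γ],[γ,λ]] ⊕ [[0,γ],[γ,−λ]]. -/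

import Mathlib

open Matrix

/-- For the block Hamiltonian `H = [[0,γI,0,0],[γI,0,A,0],[0,A†,0,γI],[0,0,γI,0]]` and a
singular triple `A|λ⟩ = λ|η⟩`, `A†|η⟩ = λ|λ⟩`, the span of `|1⟩|η⟩, |2⟩|η⟩, |3⟩|λ⟩, |4⟩|λ⟩`
is invariant and, in the basis `(|1⟩|η⟩ ± |4⟩|λ⟩)/√2`, `(|2⟩|η⟩ ± |3⟩|λ⟩)/√2`, the
restriction of `H` is `[[0,γ],[γ,λ]] ⊕ [[0,γ],[γ,−λ]]`. -/
theorem stmt2 (m n : ℕ) (γ lam : ℝ) (hγ : 0 < γ) (hlam : 0 < lam)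
    (A : Matrix (Fin m) (Fin n) ℂ)
    (η : Fin m → ℂ) (lv : Fin n → ℂ)
    (hηunit : star η ⬝ᵥ η = 1) (hlvunit : star lv ⬝ᵥ lv = 1)
    (hsv1 : A.mulVec lv = (lam : ℂ) • η)
    (hsv2 : Aᴴ.mulVec η = (lam : ℂ) • lv)
    (H : Matrix ((Fin m ⊕ Fin m) ⊕ (Fin n ⊕ Fin n)) ((Fin m ⊕ Fin m) ⊕ (Fin n ⊕ Fin n)) ℂ)
    (hH : H = Matrix.fromBlocks
        (Matrix.fromBlocks 0 ((γ : ℂ) • 1) ((γ : ℂ) • 1) 0)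
        (Matrix.fromBlocks 0 0 A 0)
        (Matrix.fromBlocks 0 Aᴴ 0 0)
        (Matrix.fromBlocks 0 ((γ : ℂ) • 1) ((γ : ℂ) • 1) 0))
    (v1p v2p v1m v2m : (Fin m ⊕ Fin m) ⊕ (Fin n ⊕ Fin n) → ℂ)
    (hv1p : v1p = (1 / Real.sqrt 2 : ℝ) • Sum.elim (Sum.elim η (0 : Fin m → ℂ)) (Sum.elim (0 : Fin n → ℂ) lv))
    (hv2p : v2p = (1 / Real.sqrt 2 : ℝ) • Sum.elim (Sum.elim (0 : Fin m → ℂ) η) (Sum.elim lv (0 : Fin n → ℂ)))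
    (hv1m : v1m = (1 / Real.sqrt 2 : ℝ) • Sum.elim (Sum.elim η (0 : Fin m → ℂ)) (Sum.elim (0 : Fin n → ℂ) (-lv)))
    (hv2m : v2m = (1 / Real.sqrt 2 : ℝ) • Sum.elim (Sum.elim (0 : Fin m → ℂ) η) (Sum.elim (-lv) (0 : Fin n → ℂ))) :
    H.mulVec v1p = (γ : ℂ) • v2p ∧
    H.mulVec v2p = (γ : ℂ) • v1p + (lam : ℂ) • v2p ∧
    H.mulVec v1m = (γ : ℂ) • v2m ∧
    H.mulVec v2m = (γ : ℂ) • v1m - (lam : ℂ) • v2m := by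
  subst hH hv1p hv2p hv1m hv2m
  refine ⟨?_, ?_, ?_, ?_⟩ <;> rw [Matrix.mulVec_smul] <;>
    ext ((i | i) | (i | i)) <;>
    simp [Matrix.fromBlocks_mulVec, Matrix.smul_mulVec, Matrix.mulVec_neg,
      Sum.elim_comp_inl, Sum.elim_comp_inr, hsv1, hsv2] <;>
    ring
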